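/- arXiv:2412.02253 — 8 statements merged into one kernel-verified Lean document; each statement's English description precedes it below -/
import Mathlib

section
/- Let q3 : (0,1) → ℝ be measurable with 0 < m ≤ q3(p) ≤ M for all p ∈ (0,1), for some constants m, M. Then the function α ↦ ∫₀¹ q3(p)^{1-α} dp is differentiable at α = 1 and its derivative there equals -∫₀¹ log q3(p) dp (the quantile Kullback–Leibler divergence). -/
open MeasureTheory Set

theorem abs_log_le_of_mem_Icc {m M x : ℝ} (hm : 0 < m) (hx : x ∈ Icc m M) :
    |Real.log x| ≤ max |Real.log m| |Real.log M| :=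
  abs_le_max_abs_abs (Real.log_le_log hm hx.1) (Real.log_le_log (hm.trans_le hx.1) hx.2)

theorem hasDerivAt_rpow_one_sub {q : ℝ} (hq : 0 < q) (x : ℝ) :
    HasDerivAt (fun α : ℝ => q ^ (1 - α)) (-(Real.log q * q ^ (1 - x))) x := by
  simpa using ((hasDerivAt_id x).const_sub 1).const_rpow hq

theorem rpow_le_exp_of_abs_log_le {q y L : ℝ} (hq : 0 < q) (hL : |Real.log q| ≤ L)
    (hy : |y| ≤ 1) : q ^ y ≤ Real.exp L := by
  rw [Real.rpow_def_of_pos hq, Real.exp_le_exp]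
  calc Real.log q * y ≤ |Real.log q| * |y| := (le_abs_self _).trans (abs_mul _ _).le
    _ ≤ |Real.log q| := mul_le_of_le_one_right (abs_nonneg _) hy
    _ ≤ L := hL

/-- The quantile relative information generating function
`α ↦ ∫₀¹ q3(p)^(1-α) dp` is differentiable at `α = 1` with derivative
`-∫₀¹ log q3(p) dp` (the quantile Kullback–Leibler divergence), provided
`q3` is measurable and bounded away from `0` and `∞` on `(0,1)`. -/
theorem relative_info_gen_hasDerivAt_one
    (q3 : ℝ → ℝ) (hmeas : Measurable q3) (m M : ℝ) (hm : 0 < m)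
    (hbound : ∀ p ∈ Ioo (0:ℝ) 1, m ≤ q3 p ∧ q3 p ≤ M) :
    HasDerivAt (fun α : ℝ => ∫ p in Ioo (0:ℝ) 1, q3 p ^ (1 - α))
      (-∫ p in Ioo (0:ℝ) 1, Real.log (q3 p)) 1 := by
  set L := max |Real.log m| |Real.log M|
  have hpos : ∀ p ∈ Ioo (0:ℝ) 1, 0 < q3 p := fun p hp => hm.trans_le (hbound p hp).1
  have hlog : ∀ p ∈ Ioo (0:ℝ) 1, |Real.log (q3 p)| ≤ L :=
    fun p hp => abs_log_le_of_mem_Icc hm (hbound p hp)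
  have key := (hasDerivAt_integral_of_dominated_loc_of_deriv_le
    (μ := volume.restrict (Ioo (0:ℝ) 1)) (x₀ := (1:ℝ))
    (F := fun α p => q3 p ^ (1 - α))
    (F' := fun α p => -(Real.log (q3 p) * q3 p ^ (1 - α)))
    (bound := fun _ => L * Real.exp L) (Metric.ball_mem_nhds (1:ℝ) one_pos)
    (Filter.Eventually.of_forall fun α => (hmeas.pow_const (1 - α)).aestronglyMeasurable)
    (by simp) (by fun_prop) ?_ (integrable_const _) ?_).2
  · simpa [integral_neg] using key
  · filter_upwards [ae_restrict_mem measurableSet_Ioo] with p hp x hx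
    have hx' : |1 - x| ≤ 1 := by
      rw [abs_sub_comm]
      exact (Metric.mem_ball.1 hx).le
    rw [norm_neg, norm_mul, Real.norm_eq_abs, Real.norm_eq_abs,
      abs_of_nonneg (Real.rpow_nonneg (hpos p hp).le _)]
    exact mul_le_mul (hlog p hp) (rpow_le_exp_of_abs_log_le (hpos p hp) (hlog p hp) hx')
      (Real.rpow_nonneg (hpos p hp).le _) ((abs_nonneg _).trans (hlog p hp))
  · filter_upwards [ae_restrict_mem measurableSet_Ioo] with p hp x _
    exact hasDerivAt_rpow_one_sub (hpos p hp) x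
end

section
/- Let q3 : (0,1) → ℝ be measurable with 0 < m ≤ q3(p) ≤ M for all p ∈ (0,1), for some constants m, M, and let k be a positive integer. Then the function α ↦ ∫₀¹ q3(p)^{1-α} dp is k times differentiable at α = 1 and its k-th derivative there equals ∫₀¹ (-log q3(p))^k dp (the quantile version of the generalized Kullback–Leibler divergence). -/
open MeasureTheory Set

/-- On `(0,1)`, the power integral of a positive function is the moment-generating function of
minus its logarithm. -/
lemma setIntegral_rpow_one_sub_eq_mgf {q : ℝ → ℝ} (hq : ∀ p ∈ Ioo (0:ℝ) 1, 0 < q p) (α : ℝ) :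
    ∫ p in Ioo (0:ℝ) 1, q p ^ (1 - α) =
      ProbabilityTheory.mgf (fun p => -Real.log (q p)) (volume.restrict (Ioo (0:ℝ) 1))
        (α - 1) := by
  refine setIntegral_congr_fun measurableSet_Ioo fun p hp => ?_
  simp only [Real.rpow_def_of_pos (hq p hp)]
  congr 1
  ring

/-- For `q3` measurable and bounded away from `0` and `∞` on `(0,1)`, the function
`α ↦ ∫₀¹ q3(p)^(1-α) dp` is `k` times differentiable at `α = 1` and its `k`-th
derivative there equals `∫₀¹ (-log q3(p))^k dp`, the quantile version of the
generalized Kullback–Leibler divergence. -/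
theorem relative_info_gen_iteratedDeriv_one
    (q3 : ℝ → ℝ) (hmeas : Measurable q3) (m M : ℝ) (hm : 0 < m)
    (hbound : ∀ p ∈ Ioo (0:ℝ) 1, m ≤ q3 p ∧ q3 p ≤ M) (k : ℕ) (hk : 0 < k) :
    ContDiffAt ℝ k (fun α : ℝ => ∫ p in Ioo (0:ℝ) 1, q3 p ^ (1 - α)) 1 ∧
    iteratedDeriv k (fun α : ℝ => ∫ p in Ioo (0:ℝ) 1, q3 p ^ (1 - α)) 1
      = ∫ p in Ioo (0:ℝ) 1, (-Real.log (q3 p)) ^ k := by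
  have hpos : ∀ p ∈ Ioo (0:ℝ) 1, 0 < q3 p := fun p hp => hm.trans_le (hbound p hp).1
  have hbdd : ∀ᵐ p ∂volume.restrict (Ioo (0:ℝ) 1),
      -Real.log (q3 p) ∈ Icc (-Real.log M) (-Real.log m) := by
    filter_upwards [ae_restrict_mem measurableSet_Ioo] with p hp
    exact ⟨neg_le_neg (Real.log_le_log (hpos p hp) (hbound p hp).2),
      neg_le_neg (Real.log_le_log hm (hbound p hp).1)⟩
  have hset : ProbabilityTheory.integrableExpSet (fun p => -Real.log (q3 p))
      (volume.restrict (Ioo (0:ℝ) 1)) = univ :=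
    eq_univ_of_forall fun t =>
      ProbabilityTheory.integrable_exp_mul_of_mem_Icc (by fun_prop) hbdd
  have hzero : (0:ℝ) ∈ interior (ProbabilityTheory.integrableExpSet
      (fun p => -Real.log (q3 p)) (volume.restrict (Ioo (0:ℝ) 1))) := by
    simp [hset]
  simp only [setIntegral_rpow_one_sub_eq_mgf hpos]
  constructor
  · refine ContDiffAt.comp (1:ℝ) (g := ProbabilityTheory.mgf _ _) ?_
      (contDiffAt_id.sub contDiffAt_const)
    simpa using (ProbabilityTheory.analyticAt_mgf hzero).contDiffAt
  · simp only [iteratedDeriv_comp_sub_const, sub_self]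
    rw [ProbabilityTheory.iteratedDeriv_mgf_zero hzero]
    simp only [Pi.pow_apply]
end

section
/- Let λ1, λ2 > 0 and α > 0 with λ1 + α(λ2 - λ1) > 0, and set q3(p) = (λ1/λ2)(1-p)^{λ1/λ2 - 1} for p ∈ (0,1) (the quantile density of Q2⁻¹∘Q1 when X1 and X2 are exponential with means λ1 and λ2, i.e. Q_i(p) = -λ_i log(1-p)). Then I_α* = ∫₀¹ q3(p)^{1-α} dp = (λ1/λ2)^{1-α} · λ2/(λ1 + α(λ2 - λ1)). -/
open MeasureTheory Set

/-- The quantile relative information generating function for two exponential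
distributions with means `λ1` and `λ2` (quantile functions `Q_i(p) = -λ_i log(1-p)`,
so that `q3(p) = (λ1/λ2)(1-p)^(λ1/λ2 - 1)`):
`I_α* = ∫₀¹ q3(p)^(1-α) dp = (λ1/λ2)^(1-α) ⬝ λ2/(λ1 + α(λ2 - λ1))`. -/
theorem relative_info_gen_exponential
    (l1 l2 α : ℝ) (h1 : 0 < l1) (h2 : 0 < l2) (hα : 0 < α)
    (hden : 0 < l1 + α * (l2 - l1)) :
    ∫ p in Ioo (0:ℝ) 1, ((l1 / l2) * (1 - p) ^ (l1 / l2 - 1)) ^ (1 - α)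
      = (l1 / l2) ^ (1 - α) * (l2 / (l1 + α * (l2 - l1))) := by
  have hr : (l1 / l2 - 1) * (1 - α) + 1 = (l1 + α * (l2 - l1)) / l2 := by
    field_simp
    ring
  have hpos : 0 < (l1 / l2 - 1) * (1 - α) + 1 := hr ▸ div_pos hden h2
  have hcongr : ∀ p ∈ Ioo (0:ℝ) 1, ((l1 / l2) * (1 - p) ^ (l1 / l2 - 1)) ^ (1 - α)
      = (l1 / l2) ^ (1 - α) * (1 - p) ^ ((l1 / l2 - 1) * (1 - α)) := by
    intro p hp
    have hp1 : 0 ≤ 1 - p := sub_nonneg.2 hp.2.le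
    rw [Real.mul_rpow (div_pos h1 h2).le (Real.rpow_nonneg hp1 _), ← Real.rpow_mul hp1]
  rw [setIntegral_congr_fun measurableSet_Ioo hcongr, integral_const_mul,
    ← integral_Ioc_eq_integral_Ioo, ← intervalIntegral.integral_of_le zero_le_one,
    intervalIntegral.integral_comp_sub_left
      (fun x : ℝ => x ^ ((l1 / l2 - 1) * (1 - α))) 1,
    sub_self, sub_zero, integral_rpow (Or.inl (by linarith)), Real.one_rpow,
    Real.zero_rpow hpos.ne', hr, sub_zero, one_div_div]
end

section
/- Let Q3 : (0,1) → (0,1) be differentiable with derivative q3 satisfying 0 < m ≤ q3(p) ≤ M for all p ∈ (0,1), for some constants m, M. Fix u ∈ (0,1). Then the function α ↦ R_α*(u) = (1 - Q3(u))^{α-1}/(1-u)^α · ∫_u^1 q3(p)^{1-α} dp is differentiable at α = 1, and its derivative there equals log((1 - Q3(u))/(1-u)) - (1/(1-u)) ∫_u^1 log q3(p) dp (the quantile form of the residual Kullback–Leibler divergence). -/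
open MeasureTheory Set

/-- Differentiation under the integral sign for `α ↦ ∫ g ^ (1 - α)` at `α = 1`, when `g` is
bounded and bounded away from zero. -/
theorem hasDerivAt_integral_rpow_one_sub {Ω : Type*} [MeasurableSpace Ω] {μ : Measure Ω}
    [IsFiniteMeasure μ] {g : Ω → ℝ} (hg : AEMeasurable g μ) {m M : ℝ} (hm : 0 < m)
    (hbound : ∀ᵐ x ∂μ, m ≤ g x ∧ g x ≤ M) :
    HasDerivAt (fun α : ℝ => ∫ x, g x ^ (1 - α) ∂μ) (-∫ x, Real.log (g x) ∂μ) 1 := by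
  set K := |Real.log m| + |Real.log M| with hK
  have hlog : ∀ x, m ≤ g x ∧ g x ≤ M → |Real.log (g x)| ≤ K := by
    rintro x ⟨h1, h2⟩
    have h3 := Real.log_le_log hm h1
    have h4 := Real.log_le_log (hm.trans_le h1) h2
    rw [abs_le]
    constructor <;>
      linarith [neg_abs_le (Real.log m), le_abs_self (Real.log M), abs_nonneg (Real.log m),
        abs_nonneg (Real.log M)]
  have key := hasDerivAt_integral_of_dominated_loc_of_deriv_le (μ := μ) (x₀ := (1 : ℝ))
    (F := fun α x => g x ^ (1 - α)) (F' := fun α x => Real.log (g x) * (-1) * g x ^ (1 - α))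
    (bound := fun _ => K * Real.exp K) (Metric.ball_mem_nhds (1 : ℝ) one_pos)
    (.of_forall fun α => (hg.pow_const (1 - α)).aestronglyMeasurable)
    (by simp)
    (((Real.measurable_log.comp_aemeasurable hg).mul_const (-1)).mul
      (hg.pow_const (1 - 1))).aestronglyMeasurable
    (by
      filter_upwards [hbound] with x hx α hα
      have hpos : 0 < g x := hm.trans_le hx.1
      have hα' : |1 - α| ≤ 1 := by
        rw [abs_sub_comm]
        exact (Metric.mem_ball.1 hα).le
      have hK0 : 0 ≤ K := by positivity
      have hexp : Real.log (g x) * (1 - α) ≤ K := calc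
        Real.log (g x) * (1 - α) ≤ |Real.log (g x)| * |1 - α| := by
          rw [← abs_mul]; exact le_abs_self _
        _ ≤ K * 1 := mul_le_mul (hlog x hx) hα' (abs_nonneg _) hK0
        _ = K := mul_one K
      rw [Real.norm_eq_abs, abs_mul, mul_neg_one, abs_neg, Real.rpow_def_of_pos hpos,
        Real.abs_exp]
      exact mul_le_mul (hlog x hx) (Real.exp_le_exp.2 hexp) (Real.exp_pos _).le hK0)
    (integrable_const _)
    (by
      filter_upwards [hbound] with x hx α _
      exact ((hasDerivAt_id α).const_sub 1).const_rpow (hm.trans_le hx.1))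
  simpa [integral_neg] using key.2

/-- The residual quantile relative information generating function
`α ↦ R_α*(u) = (1 - Q3(u))^(α-1)/(1-u)^α ⬝ ∫_u^1 q3(p)^(1-α) dp` is differentiable
at `α = 1`, with derivative `log((1 - Q3(u))/(1-u)) - (1/(1-u)) ∫_u^1 log q3(p) dp`,
the quantile form of the residual Kullback–Leibler divergence. -/
theorem residual_relative_info_gen_hasDerivAt_one
    (Q3 q3 : ℝ → ℝ)
    (hmap : ∀ p ∈ Ioo (0:ℝ) 1, Q3 p ∈ Ioo (0:ℝ) 1)
    (hderiv : ∀ p ∈ Ioo (0:ℝ) 1, HasDerivAt Q3 (q3 p) p)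
    (m M : ℝ) (hm : 0 < m)
    (hbound : ∀ p ∈ Ioo (0:ℝ) 1, m ≤ q3 p ∧ q3 p ≤ M)
    (u : ℝ) (hu : u ∈ Ioo (0:ℝ) 1) :
    HasDerivAt
      (fun α : ℝ => (1 - Q3 u) ^ (α - 1) / (1 - u) ^ α * ∫ p in Ioo u 1, q3 p ^ (1 - α))
      (Real.log ((1 - Q3 u) / (1 - u)) - (1 / (1 - u)) * ∫ p in Ioo u 1, Real.log (q3 p))
      1 := by
  have hA : 0 < 1 - Q3 u := sub_pos.2 (hmap u hu).2
  have hB : 0 < 1 - u := sub_pos.2 hu.2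
  have hmem : ∀ᵐ p ∂volume.restrict (Ioo u 1), p ∈ Ioo (0 : ℝ) 1 :=
    (ae_restrict_mem measurableSet_Ioo).mono fun p hp => ⟨hu.1.trans hp.1, hp.2⟩
  have hq : AEMeasurable q3 (volume.restrict (Ioo u 1)) :=
    (measurable_deriv Q3).aemeasurable.congr (hmem.mono fun p hp => (hderiv p hp).deriv)
  have hI := hasDerivAt_integral_rpow_one_sub hq hm (hmem.mono hbound)
  have hnum := ((hasDerivAt_id (1 : ℝ)).sub_const 1).const_rpow hA
  have hden := (hasDerivAt_id (1 : ℝ)).const_rpow hB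
  have hden0 : (1 - u) ^ (id (1 : ℝ)) ≠ 0 := (Real.rpow_pos_of_pos hB _).ne'
  refine ((hnum.div hden hden0).mul hI).congr_deriv ?_
  have hvol : ∫ _ in Ioo u 1, (1 : ℝ) = 1 - u := by
    simp [hu.2.le]
  simp only [id, sub_self, Real.rpow_zero, Real.rpow_one, hvol, Pi.div_apply]
  rw [Real.log_div hA.ne' hB.ne']
  field_simp
  ring
end

section
/- Let Q3 : (0,1) → (0,1) be continuously differentiable with derivative q3(p) > 0 for all p ∈ (0,1), with Q3(u) → 0 as u → 0⁺ and Q3(u) → 1 as u → 1⁻, and let α > 0, α ≠ 1, be such that ∫_u^1 q3(p)^{1-α} dp is finite for all u ∈ (0,1). Then the residual relative information generating function R_α*(u) = (1 - Q3(u))^{α-1}/(1-u)^α · ∫_u^1 q3(p)^{1-α} dp is constant in u on (0,1) if and only if there exists θ > 0 such that Q3(u) = 1 - (1-u)^θ for all u ∈ (0,1) (i.e., the two distributions satisfy the Cox proportional hazards model). -/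
open MeasureTheory Set

/-- No real power with nonzero, nonunit exponent agrees with an affine function at all points
of a nondegenerate interval of positive reals. -/
lemma not_rpow_eq_affine_on_Ioo {a b r m k : ℝ} (ha : 0 < a) (hab : a < b) (hr0 : r ≠ 0)
    (hr1 : r ≠ 1) : ¬ ∀ x ∈ Ioo a b, x ^ r = k + m * x := by
  intro h
  have key : ∀ x ∈ Ioo a b, x ^ (r - 1) = m / r := by
    intro x hx
    have hx0 : 0 < x := ha.trans hx.1
    have d1 : HasDerivAt (fun x : ℝ => x ^ r) (r * x ^ (r - 1)) x :=
      Real.hasDerivAt_rpow_const (Or.inl hx0.ne')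
    have d2 : HasDerivAt (fun x : ℝ => k + m * x) (m * 1) x :=
      ((hasDerivAt_id x).const_mul m).const_add k
    have heq : (fun x : ℝ => x ^ r) =ᶠ[nhds x] fun x => k + m * x :=
      Filter.eventually_of_mem (isOpen_Ioo.mem_nhds hx) h
    have := (d2.congr_of_eventuallyEq heq).unique d1
    field_simp
    linarith
  obtain ⟨x, hax, hxb⟩ := exists_between hab
  obtain ⟨y, hxy, hyb⟩ := exists_between hxb
  have hx0 : 0 < x := ha.trans hax
  have hxy' : x ^ (r - 1) = y ^ (r - 1) := by
    rw [key x ⟨hax, hxb⟩, key y ⟨hax.trans hxy, hyb⟩]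
  exact hxy.ne ((Real.rpow_left_inj hx0.le (hx0.trans hxy).le (sub_ne_zero.2 hr1)).1 hxy')

/-- A function of `u` on `(0,1)` whose hazard ratio is the constant `θ` and which tends to `1`
at `0` equals `(1 - u) ^ θ`. -/
lemma eq_one_sub_rpow_of_hasDerivAt {S s : ℝ → ℝ} {θ : ℝ}
    (hS : ∀ u ∈ Ioo (0:ℝ) 1, HasDerivAt S (s u) u)
    (hs : ∀ u ∈ Ioo (0:ℝ) 1, s u * (1 - u) = -(θ * S u))
    (h0 : Filter.Tendsto S (nhdsWithin 0 (Ioi 0)) (nhds 1)) :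
    ∀ u ∈ Ioo (0:ℝ) 1, S u = (1 - u) ^ θ := by
  have hd : ∀ u ∈ Ioo (0:ℝ) 1, HasDerivAt (fun u => S u * (1 - u) ^ (-θ)) 0 u := by
    intro u hu
    have hu1 : 0 < 1 - u := sub_pos.2 hu.2
    have := (hS u hu).mul (((hasDerivAt_id u).const_sub 1).rpow_const (p := -θ)
      (Or.inl hu1.ne'))
    refine this.congr_deriv ?_
    have e : (1 - u) ^ (-θ) = (1 - u) ^ (-θ - 1) * (1 - u) := by
      rw [← Real.rpow_add_one hu1.ne']; ring_nf
    simp only [id]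
    rw [e]
    linear_combination (1 - u) ^ (-θ - 1) * hs u hu
  intro u hu
  have hconst : ∀ v ∈ Ioo (0:ℝ) 1, S v * (1 - v) ^ (-θ) = S u * (1 - u) ^ (-θ) := fun v hv =>
    isOpen_Ioo.is_const_of_deriv_eq_zero isPreconnected_Ioo
      (fun w hw => (hd w hw).differentiableAt.differentiableWithinAt)
      (fun w hw => (hd w hw).deriv) hv hu
  have hlim : Filter.Tendsto (fun v => S v * (1 - v) ^ (-θ)) (nhdsWithin 0 (Ioi 0))
      (nhds (1 * (1 - 0) ^ (-θ))) := by
    refine h0.mul (Filter.Tendsto.mono_left ?_ nhdsWithin_le_nhds)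
    exact ((continuousAt_const.sub continuousAt_id).rpow_const (Or.inl (by simp))).tendsto
  have hev : (fun v => S v * (1 - v) ^ (-θ)) =ᶠ[nhdsWithin 0 (Ioi 0)]
      fun _ => S u * (1 - u) ^ (-θ) :=
    Filter.eventually_of_mem (Ioo_mem_nhdsGT one_pos) hconst
  have h1 := tendsto_nhds_unique (hlim.congr' hev) tendsto_const_nhds
  have hu1 : 0 < 1 - u := sub_pos.2 hu.2
  rw [Real.rpow_neg hu1.le] at h1
  have := (Real.rpow_pos_of_pos hu1 θ).ne'
  simp only [sub_zero, Real.one_rpow, mul_one] at h1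
  field_simp at h1
  exact h1.symm

lemma hasDerivAt_setIntegral_Ioo_left {g : ℝ → ℝ} {u : ℝ} (hu : u ∈ Ioo (0:ℝ) 1)
    (hg : ContinuousOn g (Ioo 0 1)) (hint : IntegrableOn g (Ioo u 1)) :
    HasDerivAt (fun v => ∫ p in Ioo v 1, g p) (-g u) u := by
  have hi : IntervalIntegrable g volume u 1 :=
    (intervalIntegrable_iff_integrableOn_Ioo_of_le hu.2.le).2 hint
  have := intervalIntegral.integral_hasDerivAt_left hi
    (hg.stronglyMeasurableAtFilter isOpen_Ioo u hu) (hg.continuousAt (isOpen_Ioo.mem_nhds hu))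
  refine this.congr_of_eventuallyEq ?_
  filter_upwards [isOpen_Ioo.mem_nhds hu] with v hv
  rw [intervalIntegral.integral_of_le hv.2.le, integral_Ioc_eq_integral_Ioo]

/-- Scaling of the tail integral of a power; valid whether or not the integral converges. -/
lemma setIntegral_Ioo_one_sub_rpow {u : ℝ} (hu : u < 1) (r : ℝ) :
    ∫ p in Ioo u 1, (1 - p) ^ r = (1 - u) ^ (r + 1) * ∫ t in (0:ℝ)..1, t ^ r := by
  have hu1 : 0 < 1 - u := sub_pos.2 hu
  have h1 : ∫ p in u..1, (1 - p) ^ r = ∫ x in (0:ℝ)..(1 - u), x ^ r := by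
    simpa using intervalIntegral.integral_comp_sub_left (a := u) (b := 1) (fun x : ℝ => x ^ r) 1
  have h2 : ∫ t in (0:ℝ)..1, ((1 - u) * t) ^ r = (1 - u)⁻¹ * ∫ x in (0:ℝ)..(1 - u), x ^ r := by
    simpa using intervalIntegral.integral_comp_mul_left (a := 0) (b := 1)
      (fun x : ℝ => x ^ r) hu1.ne'
  have h3 : ∫ t in (0:ℝ)..1, ((1 - u) * t) ^ r = (1 - u) ^ r * ∫ t in (0:ℝ)..1, t ^ r := by
    rw [← intervalIntegral.integral_const_mul]
    refine intervalIntegral.integral_congr fun t ht => ?_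
    rw [uIcc_of_le zero_le_one] at ht
    exact Real.mul_rpow hu1.le ht.1
  rw [← integral_Ioc_eq_integral_Ioo, ← intervalIntegral.integral_of_le hu.le, h1,
    Real.rpow_add_one hu1.ne']
  rw [h3] at h2
  field_simp at h2
  linarith

/-- Differentiating the identity `R_α* = c` gives an algebraic equation for the hazard ratio. -/
lemma hazard_ratio_rpow_eq {Q q : ℝ → ℝ} {α c u : ℝ}
    (hQ : ∀ p ∈ Ioo (0:ℝ) 1, Q p < 1)
    (hderiv : ∀ p ∈ Ioo (0:ℝ) 1, HasDerivAt Q (q p) p)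
    (hcont : ContinuousOn q (Ioo 0 1)) (hpos : ∀ p ∈ Ioo (0:ℝ) 1, 0 < q p)
    (hu : u ∈ Ioo (0:ℝ) 1) (hint : IntegrableOn (fun p => q p ^ (1 - α)) (Ioo u 1))
    (hc : ∀ u ∈ Ioo (0:ℝ) 1,
      (1 - Q u) ^ (α - 1) / (1 - u) ^ α * ∫ p in Ioo u 1, q p ^ (1 - α) = c) :
    (q u * (1 - u) / (1 - Q u)) ^ (1 - α) =
      c * α + c * (1 - α) * (q u * (1 - u) / (1 - Q u)) := by
  have hF := hasDerivAt_setIntegral_Ioo_left hu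
    (hcont.rpow_const (p := 1 - α) fun p hp => Or.inl (hpos p hp).ne') hint
  have heq : ∀ v ∈ Ioo (0:ℝ) 1, (∫ p in Ioo v 1, q p ^ (1 - α)) =
      c * ((1 - v) ^ α * (1 - Q v) ^ (1 - α)) := by
    intro v hv
    have hS : 0 < 1 - Q v := sub_pos.2 (hQ v hv)
    have hv1 : 0 < 1 - v := sub_pos.2 hv.2
    have e : (1 - Q v) ^ (α - 1) * (1 - Q v) ^ (1 - α) = 1 := by
      rw [← Real.rpow_add hS]; simp
    have hA := (Real.rpow_pos_of_pos hv1 α).ne'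
    rw [← hc v hv]
    field_simp
    linear_combination (-∫ p in Ioo v 1, q p ^ (1 - α)) * e
  have hS : 0 < 1 - Q u := sub_pos.2 (hQ u hu)
  have hu1 : 0 < 1 - u := sub_pos.2 hu.2
  have hG := ((((hasDerivAt_id u).const_sub 1).rpow_const (p := α) (Or.inl hu1.ne')).mul
    (((hderiv u hu).const_sub 1).rpow_const (p := 1 - α) (Or.inl hS.ne'))).const_mul c
  have hD := hF.unique (hG.congr_of_eventuallyEq
    (Filter.eventually_of_mem (isOpen_Ioo.mem_nhds hu) heq))
  simp only [id] at hD
  rw [Real.div_rpow (mul_pos (hpos u hu) hu1).le hS.le,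
    Real.mul_rpow (hpos u hu).le hu1.le, neg_eq_iff_eq_neg.1 hD]
  have e1 : (1 - u) ^ (1 - α) = (1 - u) / (1 - u) ^ α := by
    rw [Real.rpow_sub hu1, Real.rpow_one]
  have e2 : (1 - u) ^ (α - 1) = (1 - u) ^ α / (1 - u) := by
    rw [Real.rpow_sub hu1, Real.rpow_one]
  have e3 : (1 - Q u) ^ (1 - α - 1) = (1 - Q u) ^ (1 - α) / (1 - Q u) := by
    rw [Real.rpow_sub hS (1 - α) 1, Real.rpow_one]
  rw [e1, e2, e3]
  have := (Real.rpow_pos_of_pos hu1 α).ne'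
  have := (Real.rpow_pos_of_pos hS (1 - α)).ne'
  field_simp
  ring

/-- A positive continuous function on `(0,1)` whose values solve `x ^ r = k + m * x`
is constant. -/
lemma eq_of_rpow_eq_affine {h : ℝ → ℝ} {r m k : ℝ} (hh : ContinuousOn h (Ioo 0 1))
    (hpos : ∀ u ∈ Ioo (0:ℝ) 1, 0 < h u) (hr0 : r ≠ 0) (hr1 : r ≠ 1)
    (heq : ∀ u ∈ Ioo (0:ℝ) 1, h u ^ r = k + m * h u) {u v : ℝ}
    (hu : u ∈ Ioo (0:ℝ) 1) (hv : v ∈ Ioo (0:ℝ) 1) : h u = h v := by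
  have hlt : ∀ u ∈ Ioo (0:ℝ) 1, ∀ v ∈ Ioo (0:ℝ) 1, ¬ h u < h v := by
    intro u hu v hv huv
    refine not_rpow_eq_affine_on_Ioo (hpos u hu) huv hr0 hr1 (k := k) (m := m) fun x hx => ?_
    obtain ⟨w, hw, rfl⟩ := isPreconnected_Ioo.intermediate_value hu hv hh ⟨hx.1.le, hx.2.le⟩
    exact heq w hw
  exact le_antisymm (not_lt.1 (hlt v hv u hu)) (not_lt.1 (hlt u hu v hv))

/-- Characterization: the residual relative information generating function
`R_α*(u) = (1 - Q3(u))^(α-1)/(1-u)^α ⬝ ∫_u^1 q3(p)^(1-α) dp` is constant in `u` on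
`(0,1)` if and only if `Q3(u) = 1 - (1-u)^θ` for some `θ > 0`, i.e. the two
distributions satisfy the Cox proportional hazards model. -/
theorem residual_relative_info_gen_const_iff_cox
    (Q3 q3 : ℝ → ℝ)
    (hmap : ∀ p ∈ Ioo (0:ℝ) 1, Q3 p ∈ Ioo (0:ℝ) 1)
    (hderiv : ∀ p ∈ Ioo (0:ℝ) 1, HasDerivAt Q3 (q3 p) p)
    (hcont : ContinuousOn q3 (Ioo 0 1))
    (hpos : ∀ p ∈ Ioo (0:ℝ) 1, 0 < q3 p)
    (h0 : Filter.Tendsto Q3 (nhdsWithin 0 (Ioi 0)) (nhds 0))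
    (h1 : Filter.Tendsto Q3 (nhdsWithin 1 (Iio 1)) (nhds 1))
    (α : ℝ) (hα : 0 < α) (hα1 : α ≠ 1)
    (hint : ∀ u ∈ Ioo (0:ℝ) 1, IntegrableOn (fun p => q3 p ^ (1 - α)) (Ioo u 1)) :
    (∃ c : ℝ, ∀ u ∈ Ioo (0:ℝ) 1,
        (1 - Q3 u) ^ (α - 1) / (1 - u) ^ α * ∫ p in Ioo u 1, q3 p ^ (1 - α) = c)
    ↔ (∃ θ : ℝ, 0 < θ ∧ ∀ u ∈ Ioo (0:ℝ) 1, Q3 u = 1 - (1 - u) ^ θ) := by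
  constructor
  · rintro ⟨c, hc⟩
    have hS : ∀ u ∈ Ioo (0:ℝ) 1, 0 < 1 - Q3 u := fun u hu => sub_pos.2 (hmap u hu).2
    set h : ℝ → ℝ := fun u => q3 u * (1 - u) / (1 - Q3 u) with hh
    have hhpos : ∀ u ∈ Ioo (0:ℝ) 1, 0 < h u := fun u hu =>
      div_pos (mul_pos (hpos u hu) (sub_pos.2 hu.2)) (hS u hu)
    have hhcont : ContinuousOn h (Ioo 0 1) :=
      (hcont.mul (continuousOn_const.sub continuousOn_id)).div
        (continuousOn_const.sub fun p hp => (hderiv p hp).continuousAt.continuousWithinAt)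
        fun u hu => (hS u hu).ne'
    have hheq : ∀ u ∈ Ioo (0:ℝ) 1, h u ^ (1 - α) = c * α + c * (1 - α) * h u := fun u hu =>
      hazard_ratio_rpow_eq (fun p hp => (hmap p hp).2) hderiv hcont hpos hu (hint u hu) hc
    have hmid : (1 / 2 : ℝ) ∈ Ioo (0:ℝ) 1 := by norm_num
    refine ⟨h (1 / 2), hhpos _ hmid, fun u hu => ?_⟩
    have hlim : Filter.Tendsto (fun u => 1 - Q3 u) (nhdsWithin 0 (Ioi 0)) (nhds 1) := by
      simpa using h0.const_sub 1
    have := eq_one_sub_rpow_of_hasDerivAt (θ := h (1 / 2))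
      (fun u hu => (hderiv u hu).const_sub 1) (fun u hu => ?_) hlim u hu
    · linarith
    · rw [eq_of_rpow_eq_affine hhcont hhpos (sub_ne_zero.2 hα1.symm)
        (by simpa using hα.ne') hheq hmid hu, hh]
      have := (hS u hu).ne'
      field_simp
  · rintro ⟨θ, hθ, hQ⟩
    have hq : ∀ u ∈ Ioo (0:ℝ) 1, q3 u = θ * (1 - u) ^ (θ - 1) := by
      intro u hu
      have hu1 : 0 < 1 - u := sub_pos.2 hu.2
      have d := (((hasDerivAt_id u).const_sub 1).rpow_const (p := θ)
        (Or.inl hu1.ne')).const_sub 1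
      rw [(hderiv u hu).unique (d.congr_of_eventuallyEq
        (Filter.eventually_of_mem (isOpen_Ioo.mem_nhds hu) hQ))]
      simp
    refine ⟨θ ^ (1 - α) * ∫ t in (0:ℝ)..1, t ^ ((θ - 1) * (1 - α)), fun u hu => ?_⟩
    have hu1 : 0 < 1 - u := sub_pos.2 hu.2
    have hI : ∫ p in Ioo u 1, q3 p ^ (1 - α) =
        ∫ p in Ioo u 1, θ ^ (1 - α) * (1 - p) ^ ((θ - 1) * (1 - α)) := by
      refine setIntegral_congr_fun measurableSet_Ioo fun p hp => ?_
      have hp1 : 0 < 1 - p := sub_pos.2 hp.2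
      rw [hq p ⟨hu.1.trans hp.1, hp.2⟩, Real.mul_rpow hθ.le (Real.rpow_pos_of_pos hp1 _).le,
        ← Real.rpow_mul hp1.le]
    have e : (1 - u) ^ (θ * (α - 1)) / (1 - u) ^ α * (1 - u) ^ ((θ - 1) * (1 - α) + 1) = 1 := by
      rw [← Real.rpow_sub hu1, ← Real.rpow_add hu1]
      convert Real.rpow_zero (1 - u) using 2
      ring
    rw [hI, integral_const_mul, setIntegral_Ioo_one_sub_rpow hu.2, hQ u hu, sub_sub_cancel,
      ← Real.rpow_mul hu1.le]
    linear_combination (θ ^ (1 - α) * ∫ t in (0:ℝ)..1, t ^ ((θ - 1) * (1 - α))) * e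
end

section
/- Let θ > 0 and α > 0 with θ(1-α) + α > 0, and take Q3(p) = 1 - (1-p)^θ with quantile density q3(p) = θ(1-p)^{θ-1} (the Cox proportional hazards model). Then for every u ∈ (0,1), R_α*(u) = (1 - Q3(u))^{α-1}/(1-u)^α · ∫_u^1 q3(p)^{1-α} dp = θ^{1-α}/(θ(1-α) + α); in particular R_α*(u) does not depend on u. -/
open MeasureTheory Set

/-- The integral of `(1 - p) ^ r` over `(u, 1)`, for an exponent `r > -1`. -/
theorem integral_Ioo_one_sub_rpow {u r : ℝ} (hu : u ≤ 1) (hr : -1 < r) :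
    ∫ p in Ioo u 1, (1 - p) ^ r = (1 - u) ^ (r + 1) / (r + 1) := by
  rw [← integral_Ioc_eq_integral_Ioo, ← intervalIntegral.integral_of_le hu,
    intervalIntegral.integral_comp_sub_left (fun x : ℝ => x ^ r) 1, integral_rpow (Or.inl hr),
    sub_self, Real.zero_rpow (by linarith), sub_zero]

/-- Under the Cox proportional hazards model, with `Q3(p) = 1 - (1-p)^θ` and
`q3(p) = θ(1-p)^(θ-1)`, the residual relative information generating function
`R_α*(u) = (1 - Q3(u))^(α-1)/(1-u)^α ⬝ ∫_u^1 q3(p)^(1-α) dp` equals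
`θ^(1-α)/(θ(1-α) + α)` for every `u ∈ (0,1)`; in particular it does not depend
on `u`. -/
theorem residual_relative_info_gen_cox
    (θ α : ℝ) (hθ : 0 < θ) (hα : 0 < α) (hden : 0 < θ * (1 - α) + α)
    (u : ℝ) (hu : u ∈ Ioo (0:ℝ) 1) :
    (1 - (1 - (1 - u) ^ θ)) ^ (α - 1) / (1 - u) ^ α
        * ∫ p in Ioo u 1, (θ * (1 - p) ^ (θ - 1)) ^ (1 - α)
      = θ ^ (1 - α) / (θ * (1 - α) + α) := by
  have hu' : 0 < 1 - u := sub_pos.2 hu.2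
  have hcongr : ∀ p ∈ Ioo u 1, (θ * (1 - p) ^ (θ - 1)) ^ (1 - α)
      = θ ^ (1 - α) * (1 - p) ^ ((θ - 1) * (1 - α)) := fun p hp => by
    have hp' : 0 ≤ 1 - p := sub_nonneg.2 hp.2.le
    rw [Real.mul_rpow hθ.le (Real.rpow_nonneg hp' _), ← Real.rpow_mul hp']
  have hexp : (θ - 1) * (1 - α) + 1 = θ * (1 - α) + α := by ring
  have hpow : (1 - u) ^ (θ * (α - 1)) / (1 - u) ^ α * (1 - u) ^ (θ * (1 - α) + α) = 1 := by
    rw [← Real.rpow_sub hu', ← Real.rpow_add hu',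
      show θ * (α - 1) - α + (θ * (1 - α) + α) = 0 by ring, Real.rpow_zero]
  rw [setIntegral_congr_fun measurableSet_Ioo hcongr, integral_const_mul,
    integral_Ioo_one_sub_rpow hu.2.le (by linarith), hexp, sub_sub_cancel,
    ← Real.rpow_mul hu'.le]
  linear_combination θ ^ (1 - α) / (θ * (1 - α) + α) * hpow
end

section
/- Let 0 < r < 1 and α > 1/2, and take the proportional odds model Q3(p) = 1 - r(1-p)/(1 - (1-r)(1-p)) with quantile density q3(p) = r/(1 - (1-r)(1-p))². Then for every u ∈ (0,1), writing w = 1 - (1-r)(1-u), the residual relative information generating function satisfies R_α*(u) = (1 - Q3(u))^{α-1}/(1-u)^α · ∫_u^1 q3(p)^{1-α} dp = (1 - w^{2α-1}) / ((1 - w)(2α - 1) w^{α-1}). -/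
open MeasureTheory Set

/-- The integral of a real power of the affine function `1 - c (1 - p)` over `(u, 1)`. -/
theorem integral_Ioo_one_sub_mul_rpow {c s u : ℝ} (hc : c ≠ 0) (hs : -1 < s) (hu : u ≤ 1) :
    ∫ p in Ioo u 1, (1 - c * (1 - p)) ^ s
      = (1 - (1 - c * (1 - u)) ^ (s + 1)) / (c * (s + 1)) := by
  have affine (p : ℝ) : 1 - c * (1 - p) = c * p + (1 - c) := by ring
  rw [← integral_Ioc_eq_integral_Ioo, ← intervalIntegral.integral_of_le hu]
  simp only [affine]
  rw [intervalIntegral.integral_comp_mul_add (fun x : ℝ => x ^ s) hc,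
    integral_rpow (Or.inl hs), show c * 1 + (1 - c) = 1 by ring, Real.one_rpow, smul_eq_mul]
  have : s + 1 ≠ 0 := by linarith
  field_simp

/-- The power `1 - α` of the proportional odds quantile density. -/
theorem div_sq_rpow_one_sub {r x : ℝ} (hr : 0 ≤ r) (hx : 0 ≤ x) (α : ℝ) :
    (r / x ^ 2) ^ (1 - α) = r ^ (1 - α) * x ^ (2 * α - 2) := by
  rw [Real.div_rpow hr (by positivity), ← Real.rpow_natCast, ← Real.rpow_mul hx, div_eq_mul_inv,
    ← Real.rpow_neg hx]
  congr 2
  push_cast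
  ring

/-- Under the proportional odds model with constant `r ∈ (0,1)`, where
`Q3(p) = 1 - r(1-p)/(1 - (1-r)(1-p))` and `q3(p) = r/(1 - (1-r)(1-p))²`, the
residual relative information generating function satisfies, for `α > 1/2`,
`u ∈ (0,1)` and `w = 1 - (1-r)(1-u)`,
`R_α*(u) = (1 - w^(2α-1)) / ((1-w)(2α-1) w^(α-1))`. -/
theorem residual_relative_info_gen_proportional_odds
    (r α : ℝ) (hr0 : 0 < r) (hr1 : r < 1) (hα : 1 / 2 < α)
    (u : ℝ) (hu : u ∈ Ioo (0:ℝ) 1) (w : ℝ) (hw : w = 1 - (1 - r) * (1 - u)) :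
    (1 - (1 - r * (1 - u) / (1 - (1 - r) * (1 - u)))) ^ (α - 1) / (1 - u) ^ α
        * ∫ p in Ioo u 1, (r / (1 - (1 - r) * (1 - p)) ^ 2) ^ (1 - α)
      = (1 - w ^ (2 * α - 1)) / ((1 - w) * (2 * α - 1) * w ^ (α - 1)) := by
  obtain ⟨hu0, hu1⟩ := hu
  have hc : 0 < 1 - r := by linarith
  have hv : 0 < 1 - u := by linarith
  have hw0 : 0 < w := by rw [hw]; nlinarith
  have hint : ∫ p in Ioo u 1, (r / (1 - (1 - r) * (1 - p)) ^ 2) ^ (1 - α)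
      = r ^ (1 - α) * ((1 - w ^ (2 * α - 1)) / ((1 - r) * (2 * α - 1))) := by
    rw [setIntegral_congr_fun measurableSet_Ioo (g := fun p =>
      r ^ (1 - α) * (1 - (1 - r) * (1 - p)) ^ (2 * α - 2)), integral_const_mul,
      integral_Ioo_one_sub_mul_rpow hc.ne' (by linarith) hu1.le, ← hw,
      show 2 * α - 2 + 1 = 2 * α - 1 by ring]
    intro p hp
    exact div_sq_rpow_one_sub hr0.le (by nlinarith [hp.1, hp.2]) α
  have hpow : (1 - u) ^ α = (1 - u) ^ (α - 1) * (1 - u) := by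
    rw [← Real.rpow_add_one hv.ne', sub_add_cancel]
  have hr : r ^ (1 - α) = (r ^ (α - 1))⁻¹ := by
    rw [← Real.rpow_neg hr0.le, neg_sub]
  have hw1 : 1 - w = (1 - r) * (1 - u) := by rw [hw]; ring
  rw [hint, ← hw, sub_sub_cancel, Real.div_rpow (by positivity) hw0.le,
    Real.mul_rpow hr0.le hv.le, hpow, hr, hw1]
  have h2 : 2 * α - 1 ≠ 0 := by linarith
  have hrp := (Real.rpow_pos_of_pos hr0 (α - 1)).ne'
  have hvp := (Real.rpow_pos_of_pos hv (α - 1)).ne'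
  have hwp := (Real.rpow_pos_of_pos hw0 (α - 1)).ne'
  field_simp
end

section
/- Let Q3 : (0,1) → (0,1) be continuously differentiable with derivative q3(p) > 0 for all p ∈ (0,1), with Q3(u) → 0 as u → 0⁺ and Q3(u) → 1 as u → 1⁻, and let α > 0, α ≠ 1, be such that ∫₀^u q3(p)^{1-α} dp is finite for all u ∈ (0,1). Then the past-lifetime relative information generating function J_α*(u) = Q3(u)^{α-1}/u^α · ∫₀^u q3(p)^{1-α} dp is constant in u on (0,1) if and only if there exists c1 > 0 such that Q3(u) = u^{c1} for all u ∈ (0,1) (i.e., the two distributions satisfy the proportional reversed hazards model). -/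
open MeasureTheory Set

/-- A nonaffine power function agrees with a given affine function on no nontrivial interval,
so a preconnected set of positive reals on which they agree has at most one point. -/
theorem subsingleton_of_rpow_eq_affine {s : Set ℝ} (hs : IsPreconnected s)
    (hspos : ∀ x ∈ s, 0 < x) {α a b : ℝ} (hα : α ≠ 0) (hα1 : α ≠ 1)
    (h : ∀ x ∈ s, x ^ (1 - α) = a + b * x) : s.Subsingleton := by
  have key : ∀ x ∈ s, ∀ y ∈ s, ¬ x < y := by
    intro x hx y hy hxy
    have hsub : Icc x y ⊆ s := hs.Icc_subset hx hy
    have hd : ∀ z ∈ Ioo x y, (1 - α) * z ^ (-α) = b := by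
      intro z hz
      have hz0 : 0 < z := hspos z (hsub (Ioo_subset_Icc_self hz))
      have h1 : HasDerivAt (fun t : ℝ => t ^ (1 - α)) ((1 - α) * z ^ (1 - α - 1)) z :=
        Real.hasDerivAt_rpow_const (Or.inl hz0.ne')
      have h2 : HasDerivAt (fun t : ℝ => a + b * t) b z := by
        simpa using ((hasDerivAt_id z).const_mul b).const_add a
      have heq : (fun t : ℝ => t ^ (1 - α)) =ᶠ[nhds z] fun t => a + b * t := by
        filter_upwards [Ioo_mem_nhds hz.1 hz.2] with t ht
        exact h t (hsub (Ioo_subset_Icc_self ht))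
      have := h1.unique (h2.congr_of_eventuallyEq heq)
      rwa [show 1 - α - 1 = -α by ring] at this
    obtain ⟨z, hxz, hzy⟩ := exists_between hxy
    obtain ⟨w, hzw, hwy⟩ := exists_between hzy
    have hz0 : 0 < z := (hspos x hx).trans hxz
    have hzw' : z ^ (-α) = w ^ (-α) := mul_left_cancel₀ (sub_ne_zero.mpr hα1.symm)
      ((hd z ⟨hxz, hzy⟩).trans (hd w ⟨hxz.trans hzw, hwy⟩).symm)
    exact hzw.ne ((Real.rpow_left_inj hz0.le (hz0.trans hzw).le (neg_ne_zero.mpr hα)).mp hzw')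
  intro x hx y hy
  exact le_antisymm (not_lt.mp (key y hy x hx)) (not_lt.mp (key x hx y hy))

/-- The Euler equation `u * Q' u = k * Q u` on `(0,1)`, normalized by `Q 1 = 1`, forces
`Q u = u ^ k`. -/
theorem eq_rpow_of_mul_deriv_eq {Q q : ℝ → ℝ} {k : ℝ}
    (hderiv : ∀ p ∈ Ioo (0:ℝ) 1, HasDerivAt Q (q p) p)
    (h1 : Filter.Tendsto Q (nhdsWithin 1 (Iio 1)) (nhds 1))
    (hk : ∀ u ∈ Ioo (0:ℝ) 1, u * q u = k * Q u) {u : ℝ} (hu : u ∈ Ioo (0:ℝ) 1) :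
    Q u = u ^ k := by
  have hd : ∀ p ∈ Ioo (0:ℝ) 1, HasDerivAt (fun t => Q t * t ^ (-k)) 0 p := by
    intro p hp
    have h := (hderiv p hp).mul (Real.hasDerivAt_rpow_const (p := -k) (Or.inl hp.1.ne'))
    have hzero : q p * p ^ (-k) + Q p * (-k * p ^ (-k - 1)) = 0 := by
      rw [Real.rpow_sub_one hp.1.ne']
      have hp0 := hp.1.ne'
      field_simp
      linear_combination p ^ (-k) * hk p hp
    rwa [hzero] at h
  have hconst : ∀ p ∈ Ioo (0:ℝ) 1, Q p * p ^ (-k) = Q u * u ^ (-k) := fun p hp =>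
    isOpen_Ioo.is_const_of_deriv_eq_zero isPreconnected_Ioo
      (fun t ht => (hd t ht).differentiableAt.differentiableWithinAt)
      (fun t ht => (hd t ht).deriv) hp hu
  have hlim : Filter.Tendsto (fun t => Q t * t ^ (-k)) (nhdsWithin 1 (Iio 1)) (nhds 1) := by
    have h2 : Filter.Tendsto (fun t : ℝ => t ^ (-k)) (nhdsWithin 1 (Iio 1))
        (nhds ((1:ℝ) ^ (-k))) :=
      (Real.continuousAt_rpow_const 1 (-k) (Or.inl one_ne_zero)).tendsto.mono_left
        nhdsWithin_le_nhds
    simpa using h1.mul h2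
  have hev : (fun t => Q t * t ^ (-k)) =ᶠ[nhdsWithin 1 (Iio 1)] fun _ => Q u * u ^ (-k) := by
    filter_upwards [Ioo_mem_nhdsLT (zero_lt_one' ℝ)] with t ht using hconst t ht
  have h3 : Q u * u ^ (-k) = 1 :=
    tendsto_nhds_unique (tendsto_const_nhds.congr' hev.symm) hlim
  rw [Real.rpow_neg hu.1.le] at h3
  exact (div_eq_one_iff_eq (Real.rpow_pos_of_pos hu.1 k).ne').mp (by rwa [div_eq_mul_inv])

/-- Differentiation of an integral over `(0, u)` at a point of `(0, 1)`. -/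
theorem hasDerivAt_setIntegral_Ioo {f : ℝ → ℝ} (hf : ContinuousOn f (Ioo 0 1)) {u : ℝ}
    (hu : u ∈ Ioo (0:ℝ) 1) (hint : IntegrableOn f (Ioo 0 u)) :
    HasDerivAt (fun t => ∫ p in Ioo (0:ℝ) t, f p) (f u) u := by
  have hi : IntervalIntegrable f volume 0 u :=
    (intervalIntegrable_iff_integrableOn_Ioo_of_le hu.1.le).mpr hint
  have h := intervalIntegral.integral_hasDerivAt_right hi
    (hf.stronglyMeasurableAtFilter isOpen_Ioo u hu) (hf.continuousAt (isOpen_Ioo.mem_nhds hu))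
  refine h.congr_of_eventuallyEq ?_
  filter_upwards [lt_mem_nhds hu.1] with t ht
  rw [intervalIntegral.integral_of_le ht.le, integral_Ioc_eq_integral_Ioo]

/-- Characterization: the past-lifetime relative information generating function
`J_α*(u) = Q3(u)^(α-1)/u^α ⬝ ∫₀^u q3(p)^(1-α) dp` is constant in `u` on `(0,1)` if
and only if `Q3(u) = u^c1` for some `c1 > 0`, i.e. the two distributions satisfy
the proportional reversed hazards model. -/
theorem past_relative_info_gen_const_iff_prh
    (Q3 q3 : ℝ → ℝ)
    (hmap : ∀ p ∈ Ioo (0:ℝ) 1, Q3 p ∈ Ioo (0:ℝ) 1)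
    (hderiv : ∀ p ∈ Ioo (0:ℝ) 1, HasDerivAt Q3 (q3 p) p)
    (hcont : ContinuousOn q3 (Ioo 0 1))
    (hpos : ∀ p ∈ Ioo (0:ℝ) 1, 0 < q3 p)
    (h0 : Filter.Tendsto Q3 (nhdsWithin 0 (Ioi 0)) (nhds 0))
    (h1 : Filter.Tendsto Q3 (nhdsWithin 1 (Iio 1)) (nhds 1))
    (α : ℝ) (hα : 0 < α) (hα1 : α ≠ 1)
    (hint : ∀ u ∈ Ioo (0:ℝ) 1, IntegrableOn (fun p => q3 p ^ (1 - α)) (Ioo 0 u)) :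
    (∃ c : ℝ, ∀ u ∈ Ioo (0:ℝ) 1,
        Q3 u ^ (α - 1) / u ^ α * ∫ p in Ioo (0:ℝ) u, q3 p ^ (1 - α) = c)
    ↔ (∃ c1 : ℝ, 0 < c1 ∧ ∀ u ∈ Ioo (0:ℝ) 1, Q3 u = u ^ c1) := by
  constructor
  · rintro ⟨c, hc⟩
    have hx : ∀ u ∈ Ioo (0:ℝ) 1,
        (u * q3 u / Q3 u) ^ (1 - α) = c * α + c * (1 - α) * (u * q3 u / Q3 u) := by
      intro u hu
      have hu0 := hu.1
      have hQ := (hmap u hu).1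
      have hq := hpos u hu
      have hF := hasDerivAt_setIntegral_Ioo
        (hcont.rpow_const fun p hp => Or.inl (hpos p hp).ne') hu (hint u hu)
      have heq : (fun t => ∫ p in Ioo (0:ℝ) t, q3 p ^ (1 - α)) =ᶠ[nhds u]
          fun t => c * (t ^ α * Q3 t ^ (1 - α)) := by
        filter_upwards [Ioo_mem_nhds hu.1 hu.2] with t ht
        have hta := (Real.rpow_pos_of_pos ht.1 α).ne'
        have hQt := (Real.rpow_pos_of_pos (hmap t ht).1 (α - 1)).ne'
        rw [← hc t ht, show 1 - α = -(α - 1) by ring, Real.rpow_neg (hmap t ht).1.le]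
        field_simp
      have hG : HasDerivAt (fun t => c * (t ^ α * Q3 t ^ (1 - α))) _ u :=
        ((Real.hasDerivAt_rpow_const (p := α) (Or.inl hu0.ne')).mul
          ((hderiv u hu).rpow_const (p := 1 - α) (Or.inl hQ.ne'))).const_mul c
      have h := hF.unique (hG.congr_of_eventuallyEq heq)
      rw [Real.div_rpow (by positivity) hQ.le, Real.mul_rpow hu0.le hq.le, h,
        Real.rpow_sub_one hu0.ne', Real.rpow_sub_one hQ.ne', Real.rpow_sub hu0,
        Real.rpow_one]
      have hua := Real.rpow_pos_of_pos hu0 α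
      have hQa := Real.rpow_pos_of_pos hQ (1 - α)
      field_simp
    have hxpos : ∀ u ∈ Ioo (0:ℝ) 1, 0 < u * q3 u / Q3 u := fun u hu =>
      div_pos (mul_pos hu.1 (hpos u hu)) (hmap u hu).1
    have hxcont : ContinuousOn (fun u => u * q3 u / Q3 u) (Ioo 0 1) :=
      (continuousOn_id.mul hcont).div
        (fun u hu => (hderiv u hu).continuousAt.continuousWithinAt)
        fun u hu => (hmap u hu).1.ne'
    have hsub := subsingleton_of_rpow_eq_affine (isPreconnected_Ioo.image _ hxcont)
      (forall_mem_image.mpr hxpos) hα.ne' hα1 (forall_mem_image.mpr hx)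
    have hhalf : (1 / 2 : ℝ) ∈ Ioo (0:ℝ) 1 := by norm_num
    refine ⟨_, hxpos _ hhalf, fun u hu => eq_rpow_of_mul_deriv_eq hderiv h1 ?_ hu⟩
    intro v hv
    have := hsub (mem_image_of_mem _ hv) (mem_image_of_mem _ hhalf)
    exact (div_eq_iff (hmap v hv).1.ne').mp this
  · rintro ⟨k, hk, hQ⟩
    have hq : ∀ p ∈ Ioo (0:ℝ) 1, q3 p ^ (1 - α) = k ^ (1 - α) * p ^ ((k - 1) * (1 - α)) := by
      intro p hp
      have heq : Q3 =ᶠ[nhds p] fun t => t ^ k := by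
        filter_upwards [Ioo_mem_nhds hp.1 hp.2] with t ht using hQ t ht
      rw [(hderiv p hp).unique ((Real.hasDerivAt_rpow_const
        (Or.inl hp.1.ne')).congr_of_eventuallyEq heq),
        Real.mul_rpow hk.le (Real.rpow_nonneg hp.1.le _), ← Real.rpow_mul hp.1.le]
    have hqu : ∀ u ∈ Ioo (0:ℝ) 1, EqOn (fun p => q3 p ^ (1 - α))
        (fun p => k ^ (1 - α) * p ^ ((k - 1) * (1 - α))) (Ioo 0 u) :=
      fun u hu p hp => hq p ⟨hp.1, hp.2.trans hu.2⟩
    have hkα := (Real.rpow_pos_of_pos hk (1 - α)).ne'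
    have he : -1 < (k - 1) * (1 - α) := by
      have hhalf : (1 / 2 : ℝ) ∈ Ioo (0:ℝ) 1 := by norm_num
      have h := (hint _ hhalf).congr_fun (hqu _ hhalf) measurableSet_Ioo
      refine (intervalIntegral.integrableOn_Ioo_rpow_iff hhalf.1).mp ?_
      exact IntegrableOn.congr_fun (h.const_mul (k ^ (1 - α))⁻¹)
        (fun p _ => inv_mul_cancel_left₀ hkα _) measurableSet_Ioo
    refine ⟨k ^ (1 - α) / ((k - 1) * (1 - α) + 1), fun u hu => ?_⟩
    have he' : (k - 1) * (1 - α) + 1 ≠ 0 := by linarith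
    rw [setIntegral_congr_fun measurableSet_Ioo (hqu u hu), ← integral_Ioc_eq_integral_Ioo,
      ← intervalIntegral.integral_of_le hu.1.le, intervalIntegral.integral_const_mul,
      integral_rpow (Or.inl he), Real.zero_rpow he', sub_zero, hQ u hu, ← Real.rpow_mul hu.1.le]
    have hpow : u ^ (k * (α - 1)) * u ^ ((k - 1) * (1 - α) + 1) = u ^ α := by
      rw [← Real.rpow_add hu.1]
      ring_nf
    have hua := (Real.rpow_pos_of_pos hu.1 α).ne'
    rw [div_mul_eq_mul_div, div_eq_iff hua, ← hpow]
    ring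
end
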